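/- Let a₁, a₂, a₃, α be real numbers and set b = a₁ + a₂ + a₃. With J₁ = x₂p₃ − x₃p₂, J₂ = x₃p₁ − x₁p₃, J₃ = x₁p₂ − x₂p₁, define T = (a₁J₁² + a₂J₂² + a₃J₃²) − (a₁x₁² + a₂x₂² + a₃x₃²)(J₁² + J₂² + J₃²), V = (a₁x₁² + a₂x₂² + a₃x₃² − b/3)³, H = T + αV, K₁ = (a₁x₁J₁ + a₂x₂J₂ + a₃x₃J₃)², K₂ = J₁² + J₂² + J₃², W = (a₁−a₃)(a₁−a₂)x₁⁴ + (a₂−a₁)(a₂−a₃)x₂⁴ + (a₃−a₁)(a₃−a₂)x₃⁴ − (a₁² + 2a₂a₃)x₁² − (a₂² + 2a₁a₃)x₂² − (a₃² + 2a₁a₂)x₃² + b²/3, and K = K₁(K₂ − αW). Then {H, K}_S = 0 at every point of the constraint surface T*S² (where x₁²+x₂²+x₃² = 1 and x₁p₁+x₂p₂+x₃p₃ = 0). -/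

import Mathlib

noncomputable section

/-- Phase space T*ℝ³ = ℝ³ × ℝ³ with coordinates (x, p). -/
abbrev Phase : Type := (Fin 3 → ℝ) × (Fin 3 → ℝ)

/-- Canonical Poisson bracket on ℝ³ × ℝ³:
{f,g} = Σᵢ (∂f/∂xᵢ ∂g/∂pᵢ − ∂f/∂pᵢ ∂g/∂xᵢ). -/
noncomputable def pb (f g : Phase → ℝ) (z : Phase) : ℝ :=
  ∑ i : Fin 3,
    (fderiv ℝ f z (Pi.single i 1, 0) * fderiv ℝ g z (0, Pi.single i 1) -
     fderiv ℝ f z (0, Pi.single i 1) * fderiv ℝ g z (Pi.single i 1, 0))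

/-- Dirac bracket associated with constraints F₁, F₂:
{f,g}_D = {f,g} − ({F₁,f}{F₂,g} − {F₁,g}{F₂,f})/{F₁,F₂}. -/
noncomputable def dirac (F₁ F₂ f g : Phase → ℝ) (z : Phase) : ℝ :=
  pb f g z - (pb F₁ f z * pb F₂ g z - pb F₁ g z * pb F₂ f z) / pb F₁ F₂ z
/-- Sphere constraint F₁ = x₁² + x₂² + x₃² − 1. -/
def sphereF₁ : Phase → ℝ := fun z => z.1 0 ^ 2 + z.1 1 ^ 2 + z.1 2 ^ 2 - 1

/-- Sphere constraint F₂ = x₁p₁ + x₂p₂ + x₃p₃. -/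
def sphereF₂ : Phase → ℝ := fun z => z.1 0 * z.2 0 + z.1 1 * z.2 1 + z.1 2 * z.2 2

/-- Sphere Dirac bracket {·,·}_S. -/
noncomputable def diracS (f g : Phase → ℝ) (z : Phase) : ℝ :=
  dirac sphereF₁ sphereF₂ f g z

/-- Angular momentum J₁ = x₂p₃ − x₃p₂. -/
noncomputable def J1 : Phase → ℝ := fun z => z.1 1 * z.2 2 - z.1 2 * z.2 1
/-- Angular momentum J₂ = x₃p₁ − x₁p₃. -/
noncomputable def J2 : Phase → ℝ := fun z => z.1 2 * z.2 0 - z.1 0 * z.2 2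
/-- Angular momentum J₃ = x₁p₂ − x₂p₁. -/
noncomputable def J3 : Phase → ℝ := fun z => z.1 0 * z.2 1 - z.1 1 * z.2 0

/-- The differential of the `i`-th position coordinate. -/
def dx (i : Fin 3) : Phase →L[ℝ] ℝ :=
  (ContinuousLinearMap.proj i).comp (ContinuousLinearMap.fst ℝ (Fin 3 → ℝ) (Fin 3 → ℝ))

/-- The differential of the `i`-th momentum coordinate. -/
def dp (i : Fin 3) : Phase →L[ℝ] ℝ :=
  (ContinuousLinearMap.proj i).comp (ContinuousLinearMap.snd ℝ (Fin 3 → ℝ) (Fin 3 → ℝ))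

@[simp] lemma dx_apply (i : Fin 3) (w : Phase) : dx i w = w.1 i := rfl

@[simp] lemma dp_apply (i : Fin 3) (w : Phase) : dp i w = w.2 i := rfl

/-- The angular momentum vector. -/
def angular (z : Phase) : Fin 3 → ℝ := ![J1 z, J2 z, J3 z]

/-- The differentials of the components of the angular momentum. -/
def dJ (z : Phase) : Fin 3 → (Phase →L[ℝ] ℝ) :=
  ![(z.1 1 • dp 2 + z.2 2 • dx 1) - (z.1 2 • dp 1 + z.2 1 • dx 2),
    (z.1 2 • dp 0 + z.2 0 • dx 2) - (z.1 0 • dp 2 + z.2 2 • dx 0),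
    (z.1 0 • dp 1 + z.2 1 • dx 0) - (z.1 1 • dp 0 + z.2 0 • dx 1)]

/-- `f` is differentiable at `z` with `df = ∑ uᵢ dxᵢ + ∑ vᵢ dJᵢ`. -/
def HasAngularGradient (f : Phase → ℝ) (u v : Fin 3 → ℝ) (z : Phase) : Prop :=
  HasFDerivAt f (∑ i, (u i • dx i + v i • dJ z i)) z

lemma hasFDerivAt_position (i : Fin 3) (z : Phase) :
    HasFDerivAt (fun w : Phase => w.1 i) (dx i) z := (dx i).hasFDerivAt

lemma hasFDerivAt_momentum (i : Fin 3) (z : Phase) :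
    HasFDerivAt (fun w : Phase => w.2 i) (dp i) z := (dp i).hasFDerivAt

namespace HasAngularGradient

variable {f g : Phase → ℝ} {u v u' v' : Fin 3 → ℝ} {z : Phase}

lemma congr (hf : HasAngularGradient f u v z) (hu : u' = u) (hv : v' = v) :
    HasAngularGradient f u' v' z :=
  hu ▸ hv ▸ hf

lemma position (i : Fin 3) (z : Phase) :
    HasAngularGradient (fun w => w.1 i) (Pi.single i 1) 0 z := by
  refine (hasFDerivAt_position i z).congr_fderiv ?_
  simp [Pi.single_apply]

lemma angularMomentum1 (z : Phase) : HasAngularGradient J1 0 ![1, 0, 0] z := by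
  refine (((hasFDerivAt_position 1 z).mul (hasFDerivAt_momentum 2 z)).sub
    ((hasFDerivAt_position 2 z).mul (hasFDerivAt_momentum 1 z))).congr_fderiv ?_
  simp [Fin.sum_univ_three, dJ]

lemma angularMomentum2 (z : Phase) : HasAngularGradient J2 0 ![0, 1, 0] z := by
  refine (((hasFDerivAt_position 2 z).mul (hasFDerivAt_momentum 0 z)).sub
    ((hasFDerivAt_position 0 z).mul (hasFDerivAt_momentum 2 z))).congr_fderiv ?_
  simp [Fin.sum_univ_three, dJ]

lemma angularMomentum3 (z : Phase) : HasAngularGradient J3 0 ![0, 0, 1] z := by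
  refine (((hasFDerivAt_position 0 z).mul (hasFDerivAt_momentum 1 z)).sub
    ((hasFDerivAt_position 1 z).mul (hasFDerivAt_momentum 0 z))).congr_fderiv ?_
  simp [Fin.sum_univ_three, dJ]

lemma const (c : ℝ) (z : Phase) : HasAngularGradient (fun _ => c) 0 0 z := by
  refine (hasFDerivAt_const c z).congr_fderiv ?_
  simp

lemma add (hf : HasAngularGradient f u v z) (hg : HasAngularGradient g u' v' z) :
    HasAngularGradient (fun w => f w + g w) (u + u') (v + v') z := by
  refine (HasFDerivAt.add hf hg).congr_fderiv ?_
  rw [← Finset.sum_add_distrib]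
  refine Finset.sum_congr rfl fun i _ => ?_
  simp only [Pi.add_apply]
  module

lemma sub (hf : HasAngularGradient f u v z) (hg : HasAngularGradient g u' v' z) :
    HasAngularGradient (fun w => f w - g w) (u - u') (v - v') z := by
  refine (HasFDerivAt.sub hf hg).congr_fderiv ?_
  rw [← Finset.sum_sub_distrib]
  refine Finset.sum_congr rfl fun i _ => ?_
  simp only [Pi.sub_apply]
  module

lemma mul (hf : HasAngularGradient f u v z) (hg : HasAngularGradient g u' v' z) :
    HasAngularGradient (fun w => f w * g w) (f z • u' + g z • u) (f z • v' + g z • v) z := by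
  refine (HasFDerivAt.mul hf hg).congr_fderiv ?_
  rw [Finset.smul_sum, Finset.smul_sum, ← Finset.sum_add_distrib]
  refine Finset.sum_congr rfl fun i _ => ?_
  simp only [Pi.add_apply, Pi.smul_apply, smul_eq_mul]
  module

lemma const_mul (c : ℝ) (hf : HasAngularGradient f u v z) :
    HasAngularGradient (fun w => c * f w) (c • u) (c • v) z := by
  simpa using (const c z).mul hf

lemma pow (hf : HasAngularGradient f u v z) (n : ℕ) :
    HasAngularGradient (fun w => f w ^ n) ((n * f z ^ (n - 1)) • u)
      ((n * f z ^ (n - 1)) • v) z := by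
  refine (HasFDerivAt.pow hf n).congr_fderiv ?_
  rw [Finset.smul_sum]
  refine Finset.sum_congr rfl fun i _ => ?_
  simp only [Pi.smul_apply, smul_eq_mul, nsmul_eq_mul]
  module

open Matrix in
/-- The canonical bracket restricts to the Lie–Poisson bracket of `e(3)`. -/
lemma pb_eq (hf : HasAngularGradient f u v z) (hg : HasAngularGradient g u' v' z) :
    pb f g z = angular z ⬝ᵥ (v ⨯₃ v') + z.1 ⬝ᵥ (v ⨯₃ u') + z.1 ⬝ᵥ (u ⨯₃ v') := by
  rw [pb, HasFDerivAt.fderiv hf, HasFDerivAt.fderiv hg]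
  simp only [vec3_dotProduct]
  simp [Fin.sum_univ_three, dJ, angular, cross_apply, J1, J2, J3]
  ring

/-- Functions of position and angular momentum commute with the squared radius. -/
lemma pb_sphereF₁ (hf : HasAngularGradient f u v z) : pb sphereF₁ f z = 0 := by
  have h : HasAngularGradient sphereF₁ _ _ z :=
    ((((position 0 z).pow 2).add ((position 1 z).pow 2)).add ((position 2 z).pow 2)).sub
      (const 1 z)
  rw [h.pb_eq hf]
  simp only [Matrix.vec3_dotProduct]
  simp [cross_apply]
  ring

lemma diracS_eq_pb (hf : HasAngularGradient f u v z) (hg : HasAngularGradient g u' v' z) :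
    diracS f g z = pb f g z := by
  simp [diracS, dirac, hf.pb_sphereF₁, hg.pb_sphereF₁]

open Matrix in
lemma pb_sq_mul {k : Phase → ℝ} {u'' v'' : Fin 3 → ℝ} (hf : HasAngularGradient f u v z)
    (hg : HasAngularGradient g u' v' z) (hk : HasAngularGradient k u'' v'' z) :
    pb f (fun w => g w ^ 2 * k w) z =
      2 * g z * k z * pb f g z + g z ^ 2 * pb f k z := by
  rw [hf.pb_eq ((hg.pow 2).mul hk), hf.pb_eq hg, hf.pb_eq hk]
  simp only [vec3_dotProduct]
  simp [cross_apply]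
  ring

end HasAngularGradient

/-- The function `A = a₁x₁² + a₂x₂² + a₃x₃²`. -/
def quadricForm (a₁ a₂ a₃ : ℝ) (w : Phase) : ℝ :=
  a₁ * w.1 0 ^ 2 + a₂ * w.1 1 ^ 2 + a₃ * w.1 2 ^ 2

/-- The squared angular momentum. -/
def angularSq (w : Phase) : ℝ := J1 w ^ 2 + J2 w ^ 2 + J3 w ^ 2

/-- The Hamiltonian `H = T + αV`. -/
def hamiltonian (a₁ a₂ a₃ α b : ℝ) (w : Phase) : ℝ :=
  ((a₁ * J1 w ^ 2 + a₂ * J2 w ^ 2 + a₃ * J3 w ^ 2) -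
    quadricForm a₁ a₂ a₃ w * angularSq w) + α * (quadricForm a₁ a₂ a₃ w - b / 3) ^ 3

/-- The square root `a₁x₁J₁ + a₂x₂J₂ + a₃x₃J₃` of `K₁`. -/
def linearFactor (a₁ a₂ a₃ : ℝ) (w : Phase) : ℝ :=
  a₁ * w.1 0 * J1 w + a₂ * w.1 1 * J2 w + a₃ * w.1 2 * J3 w

/-- The quartic potential `W`. -/
def quarticPotential (a₁ a₂ a₃ b : ℝ) (w : Phase) : ℝ :=
  (a₁ - a₃) * (a₁ - a₂) * w.1 0 ^ 4 + (a₂ - a₁) * (a₂ - a₃) * w.1 1 ^ 4 +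
    (a₃ - a₁) * (a₃ - a₂) * w.1 2 ^ 4 - (a₁ ^ 2 + 2 * a₂ * a₃) * w.1 0 ^ 2 -
    (a₂ ^ 2 + 2 * a₁ * a₃) * w.1 1 ^ 2 - (a₃ ^ 2 + 2 * a₁ * a₂) * w.1 2 ^ 2 + b ^ 2 / 3

/-- The cofactor `K₂ - αW`. -/
def quadraticFactor (a₁ a₂ a₃ α b : ℝ) (w : Phase) : ℝ :=
  angularSq w - α * quarticPotential a₁ a₂ a₃ b w

/-- Half the bracket of `A` with the squared angular momentum. -/
def cofactor (a₁ a₂ a₃ : ℝ) (z : Phase) : ℝ :=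
  2 * (z.1 0 * (a₂ * z.1 1 * J3 z - a₃ * z.1 2 * J2 z) +
    z.1 1 * (a₃ * z.1 2 * J1 z - a₁ * z.1 0 * J3 z) +
    z.1 2 * (a₁ * z.1 0 * J2 z - a₂ * z.1 1 * J1 z))

section

open HasAngularGradient

variable (a₁ a₂ a₃ α b : ℝ) (z : Phase)

lemma hasAngularGradient_quadricForm :
    HasAngularGradient (quadricForm a₁ a₂ a₃)
      ![2 * a₁ * z.1 0, 2 * a₂ * z.1 1, 2 * a₃ * z.1 2] 0 z := by
  refine congr (((((position 0 z).pow 2).const_mul a₁).add (((position 1 z).pow 2).const_mul a₂)).add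
    (((position 2 z).pow 2).const_mul a₃)) ?_ ?_
  · ext i
    fin_cases i <;> simp <;> ring
  · simp

lemma hasAngularGradient_angularSq :
    HasAngularGradient angularSq 0 ![2 * J1 z, 2 * J2 z, 2 * J3 z] z := by
  refine congr ((((angularMomentum1 z).pow 2).add ((angularMomentum2 z).pow 2)).add
    ((angularMomentum3 z).pow 2)) ?_ ?_
  · simp
  · ext i
    fin_cases i <;> simp

lemma hasAngularGradient_hamiltonian :
    HasAngularGradient (hamiltonian a₁ a₂ a₃ α b)
      ((3 * α * (quadricForm a₁ a₂ a₃ z - b / 3) ^ 2 - angularSq z) •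
        ![2 * a₁ * z.1 0, 2 * a₂ * z.1 1, 2 * a₃ * z.1 2])
      ![2 * (a₁ - quadricForm a₁ a₂ a₃ z) * J1 z, 2 * (a₂ - quadricForm a₁ a₂ a₃ z) * J2 z,
        2 * (a₃ - quadricForm a₁ a₂ a₃ z) * J3 z] z := by
  have hA := hasAngularGradient_quadricForm a₁ a₂ a₃ z
  refine congr (((((((angularMomentum1 z).pow 2).const_mul a₁).add
    (((angularMomentum2 z).pow 2).const_mul a₂)).add
    (((angularMomentum3 z).pow 2).const_mul a₃)).sub (hA.mul (hasAngularGradient_angularSq z))).add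
    (((hA.sub (const (b / 3) z)).pow 3).const_mul α)) ?_ ?_
  · ext i
    fin_cases i <;> simp <;> ring
  · ext i
    fin_cases i <;> simp <;> ring

lemma hasAngularGradient_linearFactor :
    HasAngularGradient (linearFactor a₁ a₂ a₃) ![a₁ * J1 z, a₂ * J2 z, a₃ * J3 z]
      ![a₁ * z.1 0, a₂ * z.1 1, a₃ * z.1 2] z := by
  refine congr (((((position 0 z).const_mul a₁).mul (angularMomentum1 z)).add
    (((position 1 z).const_mul a₂).mul (angularMomentum2 z))).add
    (((position 2 z).const_mul a₃).mul (angularMomentum3 z))) ?_ ?_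
  · ext i
    fin_cases i <;> simp <;> ring
  · ext i
    fin_cases i <;> simp

lemma hasAngularGradient_quarticPotential :
    HasAngularGradient (quarticPotential a₁ a₂ a₃ b)
      ![4 * ((a₁ - a₃) * (a₁ - a₂)) * z.1 0 ^ 3 - 2 * (a₁ ^ 2 + 2 * a₂ * a₃) * z.1 0,
        4 * ((a₂ - a₁) * (a₂ - a₃)) * z.1 1 ^ 3 - 2 * (a₂ ^ 2 + 2 * a₁ * a₃) * z.1 1,
        4 * ((a₃ - a₁) * (a₃ - a₂)) * z.1 2 ^ 3 - 2 * (a₃ ^ 2 + 2 * a₁ * a₂) * z.1 2] 0 z := by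
  refine congr ((((((((position 0 z).pow 4).const_mul ((a₁ - a₃) * (a₁ - a₂))).add
    (((position 1 z).pow 4).const_mul ((a₂ - a₁) * (a₂ - a₃)))).add
    (((position 2 z).pow 4).const_mul ((a₃ - a₁) * (a₃ - a₂)))).sub
    (((position 0 z).pow 2).const_mul (a₁ ^ 2 + 2 * a₂ * a₃))).sub
    (((position 1 z).pow 2).const_mul (a₂ ^ 2 + 2 * a₁ * a₃))).sub
    (((position 2 z).pow 2).const_mul (a₃ ^ 2 + 2 * a₁ * a₂)) |>.add (const (b ^ 2 / 3) z)) ?_ ?_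
  · ext i
    fin_cases i <;> simp <;> ring
  · simp

lemma hasAngularGradient_quadraticFactor :
    HasAngularGradient (quadraticFactor a₁ a₂ a₃ α b)
      (-α • ![4 * ((a₁ - a₃) * (a₁ - a₂)) * z.1 0 ^ 3 - 2 * (a₁ ^ 2 + 2 * a₂ * a₃) * z.1 0,
        4 * ((a₂ - a₁) * (a₂ - a₃)) * z.1 1 ^ 3 - 2 * (a₂ ^ 2 + 2 * a₁ * a₃) * z.1 1,
        4 * ((a₃ - a₁) * (a₃ - a₂)) * z.1 2 ^ 3 - 2 * (a₃ ^ 2 + 2 * a₁ * a₂) * z.1 2])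
      ![2 * J1 z, 2 * J2 z, 2 * J3 z] z := by
  refine congr ((hasAngularGradient_angularSq z).sub
    ((hasAngularGradient_quarticPotential a₁ a₂ a₃ b z).const_mul α)) ?_ ?_ <;> simp

variable {z}

lemma pb_hamiltonian_linearFactor (h : z.1 0 ^ 2 + z.1 1 ^ 2 + z.1 2 ^ 2 = 1) :
    pb (hamiltonian a₁ a₂ a₃ α b) (linearFactor a₁ a₂ a₃) z =
      cofactor a₁ a₂ a₃ z * linearFactor a₁ a₂ a₃ z := by
  rw [(hasAngularGradient_hamiltonian a₁ a₂ a₃ α b z).pb_eq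
    (hasAngularGradient_linearFactor a₁ a₂ a₃ z)]
  simp only [angular, Matrix.vec3_dotProduct, cross_apply, cofactor, linearFactor, quadricForm,
    angularSq, J1, J2, J3, Pi.smul_apply, smul_eq_mul, Matrix.cons_val]
  linear_combination (-2 * (
    (z.1 1 * z.2 2 - z.1 2 * z.2 1) * (a₂ * (z.1 2 * z.2 0 - z.1 0 * z.2 2) * (a₃ * z.1 2) -
      a₃ * (z.1 0 * z.2 1 - z.1 1 * z.2 0) * (a₂ * z.1 1)) +
    (z.1 2 * z.2 0 - z.1 0 * z.2 2) * (a₃ * (z.1 0 * z.2 1 - z.1 1 * z.2 0) * (a₁ * z.1 0) -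
      a₁ * (z.1 1 * z.2 2 - z.1 2 * z.2 1) * (a₃ * z.1 2)) +
    (z.1 0 * z.2 1 - z.1 1 * z.2 0) * (a₁ * (z.1 1 * z.2 2 - z.1 2 * z.2 1) * (a₂ * z.1 1) -
      a₂ * (z.1 2 * z.2 0 - z.1 0 * z.2 2) * (a₁ * z.1 0)))) * h

open Matrix in
lemma pb_hamiltonian_quadraticFactor (h : z.1 0 ^ 2 + z.1 1 ^ 2 + z.1 2 ^ 2 = 1) :
    pb (hamiltonian a₁ a₂ a₃ α (a₁ + a₂ + a₃)) (quadraticFactor a₁ a₂ a₃ α (a₁ + a₂ + a₃)) z =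
      -2 * cofactor a₁ a₂ a₃ z * quadraticFactor a₁ a₂ a₃ α (a₁ + a₂ + a₃) z := by
  obtain ⟨g, hg⟩ : ∃ g, g = ![2 * (a₁ ^ 2 + 2 * a₂ * a₃) * z.1 0,
      2 * (a₂ ^ 2 + 2 * a₁ * a₃) * z.1 1, 2 * (a₃ ^ 2 + 2 * a₁ * a₂) * z.1 2] := ⟨_, rfl⟩
  obtain ⟨q, hq⟩ : ∃ q, q = ![4 * ((a₁ - a₃) * (a₁ - a₂)) * z.1 0 ^ 3,
      4 * ((a₂ - a₁) * (a₂ - a₃)) * z.1 1 ^ 3, 4 * ((a₃ - a₁) * (a₃ - a₂)) * z.1 2 ^ 3] := ⟨_, rfl⟩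
  obtain ⟨v, hv⟩ : ∃ v, v = ![2 * a₁ * J1 z, 2 * a₂ * J2 z, 2 * a₃ * J3 z] := ⟨_, rfl⟩
  obtain ⟨j, hj⟩ : ∃ j, j = ![2 * J1 z, 2 * J2 z, 2 * J3 z] := ⟨_, rfl⟩
  have key := congrArg (fun t => α * ((z.1 ⬝ᵥ (v ⨯₃ g)) *
      (1 + (z.1 0 ^ 2 + z.1 1 ^ 2 + z.1 2 ^ 2))
    - (z.1 ⬝ᵥ (v ⨯₃ q) + quadricForm a₁ a₂ a₃ z * (z.1 ⬝ᵥ (j ⨯₃ g))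
      + 4 * cofactor a₁ a₂ a₃ z * (a₁ + a₂ + a₃) * quadricForm a₁ a₂ a₃ z
      - 2 * cofactor a₁ a₂ a₃ z * ((a₁ ^ 2 + 2 * a₂ * a₃) * z.1 0 ^ 2 +
        (a₂ ^ 2 + 2 * a₁ * a₃) * z.1 1 ^ 2 + (a₃ ^ 2 + 2 * a₁ * a₂) * z.1 2 ^ 2))) * t) h
  rw [(hasAngularGradient_hamiltonian a₁ a₂ a₃ α _ z).pb_eq
    (hasAngularGradient_quadraticFactor a₁ a₂ a₃ α _ z)]
  subst hg hq hv hj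
  simp only [angular, vec3_dotProduct, cross_apply, cofactor, quadraticFactor, quarticPotential,
    quadricForm, angularSq, J1, J2, J3, Pi.smul_apply, smul_eq_mul, cons_val] at key ⊢
  linear_combination -key

end

/-- H = T + αV and K = K₁(K₂ − αW) are in involution with respect
to the sphere Dirac bracket on T*S². -/
theorem quartic_metric_with_potential_sphere_involution
    (a₁ a₂ a₃ α : ℝ) (b : ℝ) (hb : b = a₁ + a₂ + a₃)
    (z : Phase)
    (h1 : z.1 0 ^ 2 + z.1 1 ^ 2 + z.1 2 ^ 2 = 1)
    (h2 : z.1 0 * z.2 0 + z.1 1 * z.2 1 + z.1 2 * z.2 2 = 0) :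
    diracS
      (fun w =>
        ((a₁ * J1 w ^ 2 + a₂ * J2 w ^ 2 + a₃ * J3 w ^ 2) -
          (a₁ * w.1 0 ^ 2 + a₂ * w.1 1 ^ 2 + a₃ * w.1 2 ^ 2) *
            (J1 w ^ 2 + J2 w ^ 2 + J3 w ^ 2)) +
        α * (a₁ * w.1 0 ^ 2 + a₂ * w.1 1 ^ 2 + a₃ * w.1 2 ^ 2 - b / 3) ^ 3)
      (fun w =>
        (a₁ * w.1 0 * J1 w + a₂ * w.1 1 * J2 w + a₃ * w.1 2 * J3 w) ^ 2 *
        ((J1 w ^ 2 + J2 w ^ 2 + J3 w ^ 2) -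
          α * ((a₁ - a₃) * (a₁ - a₂) * w.1 0 ^ 4 +
               (a₂ - a₁) * (a₂ - a₃) * w.1 1 ^ 4 +
               (a₃ - a₁) * (a₃ - a₂) * w.1 2 ^ 4 -
               (a₁ ^ 2 + 2 * a₂ * a₃) * w.1 0 ^ 2 -
               (a₂ ^ 2 + 2 * a₁ * a₃) * w.1 1 ^ 2 -
               (a₃ ^ 2 + 2 * a₁ * a₂) * w.1 2 ^ 2 + b ^ 2 / 3))) z = 0 := by
  subst hb
  have hH := hasAngularGradient_hamiltonian a₁ a₂ a₃ α (a₁ + a₂ + a₃) z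
  have hL := hasAngularGradient_linearFactor a₁ a₂ a₃ z
  have hM := hasAngularGradient_quadraticFactor a₁ a₂ a₃ α (a₁ + a₂ + a₃) z
  refine (hH.diracS_eq_pb ((hL.pow 2).mul hM)).trans ?_
  rw [hH.pb_sq_mul hL hM, pb_hamiltonian_linearFactor a₁ a₂ a₃ α _ h1,
    pb_hamiltonian_quadraticFactor a₁ a₂ a₃ α h1]
  ring
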